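/- arXiv:math/0305123 — 2 statements merged into one kernel-verified Lean document; each statement's English description precedes it below -/
import Mathlib

section
/- For every integer j ≥ 0: p_j(Δ) δ_0 = q^{2jn} · [(q²;q²)_{n−1} / (q^{2j+2};q²)_{n−1}] · δ_j, where δ_k : ℤ_{≥0} → ℂ is the function with δ_k(l) = δ_{kl}, Δ is the radial q-Laplace–Beltrami operator, and p_j(Δ) is the polynomial p_j evaluated at the operator Δ. -/
/-- The q²-shifted factorial `(a; q²)_m = ∏_{j=0}^{m-1} (1 − a q^{2j})`. -/
noncomputable def qpochC (q : ℝ) (a : ℂ) (m : ℕ) : ℂ :=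
  ∏ j ∈ Finset.range m, (1 - a * (q : ℂ) ^ (2 * j))

/-- The radial q-Laplace–Beltrami operator as a linear endomorphism of `ℕ → ℂ`:
`(Δg)(j) = q²/(1−q²)² [(1−q^{2j}) g(j−1) − (1+q^{−2n}−2q^{2j}) g(j) + (q^{−2n}−q^{2j}) g(j+1)]`,
the `g(j−1)` term being absent for `j = 0`. -/
noncomputable def DeltaOp (q : ℝ) (n : ℕ) : Module.End ℂ (ℕ → ℂ) where
  toFun g := fun j =>
    (q : ℂ) ^ 2 / (1 - (q : ℂ) ^ 2) ^ 2 *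
      ((1 - (q : ℂ) ^ (2 * j)) * (if j = 0 then 0 else g (j - 1)) -
        (1 + ((q : ℂ) ^ (2 * n))⁻¹ - 2 * (q : ℂ) ^ (2 * j)) * g j +
        (((q : ℂ) ^ (2 * n))⁻¹ - (q : ℂ) ^ (2 * j)) * g (j + 1))
  map_add' g h := by
    funext j
    simp only [Pi.add_apply]
    split <;> ring
  map_smul' c g := by
    funext j
    simp only [Pi.smul_apply, smul_eq_mul, RingHom.id_apply]
    split <;> ring

/-- The polynomial `p_j(x) = Σ_{l=0}^{j} (q^{−2j};q²)_l q^{2l} / ((q^{2n};q²)_l (q²;q²)_l)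
  · ∏_{m=0}^{l−1} [(1 − q^{2m})(1 − q^{2m+2n}) − q^{2m+2n−2}(1 − q²)² x]`. -/
noncomputable def pBerPoly (q : ℝ) (n j : ℕ) : Polynomial ℂ :=
  ∑ l ∈ Finset.range (j + 1),
    Polynomial.C (qpochC q (((q : ℂ) ^ (2 * j))⁻¹) l * (q : ℂ) ^ (2 * l) /
        (qpochC q ((q : ℂ) ^ (2 * n)) l * qpochC q ((q : ℂ) ^ 2) l)) *
      ∏ m ∈ Finset.range l,
        (Polynomial.C ((1 - (q : ℂ) ^ (2 * m)) * (1 - (q : ℂ) ^ (2 * m + 2 * n))) -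
          Polynomial.C ((q : ℂ) ^ (2 * m + 2 * n - 2) * (1 - (q : ℂ) ^ 2) ^ 2) * Polynomial.X)

lemma qpochC_succ (q : ℝ) (a : ℂ) (m : ℕ) :
    qpochC q a (m + 1) = qpochC q a m * (1 - a * (q : ℂ) ^ (2 * m)) :=
  Finset.prod_range_succ _ _

lemma qpochC_succ_left (q : ℝ) (a : ℂ) (m : ℕ) :
    qpochC q a (m + 1) = (1 - a) * qpochC q (a * (q : ℂ) ^ 2) m := by
  unfold qpochC
  rw [Finset.prod_range_succ', mul_comm]
  congr 1
  · simp
  · exact Finset.prod_congr rfl fun i _ => by ring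

lemma one_sub_ofReal_pow_ne_zero {q : ℝ} (hq0 : 0 < q) (hq1 : q < 1) {k : ℕ} (hk : k ≠ 0) :
    1 - (q : ℂ) ^ k ≠ 0 := by
  rw [sub_ne_zero]
  exact_mod_cast (pow_lt_one₀ hq0.le hq1 hk).ne'

lemma qpochC_pow_ne_zero {q : ℝ} (hq0 : 0 < q) (hq1 : q < 1) {k : ℕ} (hk : k ≠ 0) (m : ℕ) :
    qpochC q ((q : ℂ) ^ k) m ≠ 0 := by
  refine Finset.prod_ne_zero_iff.mpr fun i _ => ?_
  rw [← pow_add]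
  exact one_sub_ofReal_pow_ne_zero hq0 hq1 (by omega)

lemma qpochC_inv_pow_eq_zero {q : ℝ} (hq0 : 0 < q) {j m : ℕ} (h : j < m) :
    qpochC q (((q : ℂ) ^ (2 * j))⁻¹) m = 0 := by
  refine Finset.prod_eq_zero (Finset.mem_range.mpr h) ?_
  have : (q : ℂ) ≠ 0 := by exact_mod_cast hq0.ne'
  rw [inv_mul_cancel₀ (pow_ne_zero _ this), sub_self]

/-- The coefficient `(z;q²)_l q^{2l} / ((q^{2n};q²)_l (q²;q²)_l)` of the basic hypergeometric
sum. -/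
noncomputable def berCoeff (q : ℝ) (n : ℕ) (z : ℂ) (l : ℕ) : ℂ :=
  qpochC q z l * (q : ℂ) ^ (2 * l) / (qpochC q ((q : ℂ) ^ (2 * n)) l * qpochC q ((q : ℂ) ^ 2) l)

/-- The product `∏_{m<l} [(1 − q^{2m})(1 − q^{2m+2n}) − q^{2m} y]`. -/
noncomputable def berBasis (q : ℝ) (n : ℕ) (y : ℂ) (l : ℕ) : ℂ :=
  ∏ m ∈ Finset.range l,
    ((1 - (q : ℂ) ^ (2 * m)) * (1 - (q : ℂ) ^ (2 * m + 2 * n)) - (q : ℂ) ^ (2 * m) * y)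

lemma berBasis_succ (q : ℝ) (n : ℕ) (y : ℂ) (l : ℕ) :
    berBasis q n y (l + 1) = berBasis q n y l *
      ((1 - (q : ℂ) ^ (2 * l)) * (1 - (q : ℂ) ^ (2 * l + 2 * n)) - (q : ℂ) ^ (2 * l) * y) :=
  Finset.prod_range_succ _ _

/-- The contiguous relation in `z` for the truncated basic hypergeometric sums. -/
lemma sum_berCoeff_contiguous {q : ℝ} (hq0 : 0 < q) (hq1 : q < 1) {n : ℕ} (hn : 1 ≤ n)
    {z : ℂ} (hz : z ≠ 0) (y : ℂ) (N : ℕ) :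
    ∑ l ∈ Finset.range (N + 1),
      ((1 - (q : ℂ) ^ (2 * n) / z) * berCoeff q n (z / (q : ℂ) ^ 2) l
        - (1 + (q : ℂ) ^ (2 * n) - 2 * (q : ℂ) ^ (2 * n) / z + y) * berCoeff q n z l
        - (q : ℂ) ^ (2 * n) / z * ((1 - z) * berCoeff q n (z * (q : ℂ) ^ 2) l)) * berBasis q n y l
      = berCoeff q n z N / (q : ℂ) ^ (2 * N) * berBasis q n y (N + 1) := by
  have hq : (q : ℂ) ≠ 0 := by exact_mod_cast hq0.ne'
  induction N with
  | zero =>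
    simp [berCoeff, berBasis, qpochC]
    field_simp
    ring
  | succ N ih =>
    rw [Finset.sum_range_succ, ih, berBasis_succ q n y (N + 1)]
    have h1 : qpochC q (z / (q : ℂ) ^ 2) (N + 1) = (1 - z / (q : ℂ) ^ 2) * qpochC q z N := by
      rw [qpochC_succ_left, div_mul_cancel₀ _ (pow_ne_zero 2 hq)]
    have h2 : (1 - z) * qpochC q (z * (q : ℂ) ^ 2) (N + 1) = qpochC q z N *
        (1 - z * (q : ℂ) ^ (2 * N)) * (1 - z * (q : ℂ) ^ (2 * (N + 1))) := by
      rw [← qpochC_succ_left, qpochC_succ, qpochC_succ]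
    have hA := qpochC_pow_ne_zero hq0 hq1 (k := 2 * n) (by omega) N
    have hB := qpochC_pow_ne_zero hq0 hq1 (k := 2) (by omega) N
    have ha := one_sub_ofReal_pow_ne_zero hq0 hq1 (k := 2 * n + 2 * N) (by omega)
    have hb := one_sub_ofReal_pow_ne_zero hq0 hq1 (k := 2 + 2 * N) (by omega)
    have h3 : (1 - z) * berCoeff q n (z * (q : ℂ) ^ 2) (N + 1) = qpochC q z N *
        (1 - z * (q : ℂ) ^ (2 * N)) * (1 - z * (q : ℂ) ^ (2 * (N + 1))) * (q : ℂ) ^ (2 * (N + 1)) /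
        (qpochC q ((q : ℂ) ^ (2 * n)) (N + 1) * qpochC q ((q : ℂ) ^ 2) (N + 1)) := by
      rw [← h2, berCoeff]; ring
    rw [h3]
    simp only [berCoeff, h1, qpochC_succ]
    generalize berBasis q n y (N + 1) = φ
    generalize qpochC q z N = Z
    generalize qpochC q ((q : ℂ) ^ (2 * n)) N = A at *
    generalize qpochC q ((q : ℂ) ^ 2) N = B at *
    simp only [mul_add, mul_one, pow_add] at *
    have hqN := pow_ne_zero (2 * N) hq
    generalize (q : ℂ) ^ (2 * N) = u at *
    generalize (q : ℂ) ^ (2 * n) = a at *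
    have ha' : 1 - u * a ≠ 0 := by rwa [mul_comm]
    have hb' : 1 - u * (q : ℂ) ^ 2 ≠ 0 := by rwa [mul_comm]
    field_simp
    ring

lemma eval_pBerPoly {q : ℝ} (hq0 : 0 < q) {n : ℕ} (hn : 1 ≤ n) {j N : ℕ} (hN : j < N) (x : ℂ) :
    (pBerPoly q n j).eval x = ∑ l ∈ Finset.range N, berCoeff q n (((q : ℂ) ^ (2 * j))⁻¹) l *
      berBasis q n ((q : ℂ) ^ (2 * n - 2) * (1 - (q : ℂ) ^ 2) ^ 2 * x) l := by
  have hsub : Finset.range (j + 1) ⊆ Finset.range N := Finset.range_mono hN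
  rw [← Finset.sum_subset hsub]
  · simp only [pBerPoly, Polynomial.eval_finsetSum, Polynomial.eval_mul, Polynomial.eval_C,
      Polynomial.eval_prod, Polynomial.eval_sub, Polynomial.eval_X, berCoeff, berBasis]
    refine Finset.sum_congr rfl fun l _ => ?_
    congr 1
    refine Finset.prod_congr rfl fun m _ => ?_
    rw [Nat.add_sub_assoc (by omega), pow_add _ _ (2 * n - 2)]
    ring
  · intro l _ hl
    rw [Finset.mem_range, not_lt] at hl
    simp [berCoeff, qpochC_inv_pow_eq_zero hq0 (Nat.lt_of_succ_le hl)]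

/-- The three-term recurrence of the polynomials `p_j`. -/
lemma pBerPoly_recurrence {q : ℝ} (hq0 : 0 < q) (hq1 : q < 1) {n : ℕ} (hn : 1 ≤ n) (j : ℕ) :
    Polynomial.C (1 - (q : ℂ) ^ (2 * n) * (q : ℂ) ^ (2 * j)) * pBerPoly q n (j + 1) =
      (Polynomial.C ((q : ℂ) ^ (2 * n - 2) * (1 - (q : ℂ) ^ 2) ^ 2) * Polynomial.X +
        Polynomial.C (1 + (q : ℂ) ^ (2 * n) - 2 * (q : ℂ) ^ (2 * n) * (q : ℂ) ^ (2 * j))) *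
          pBerPoly q n j -
      Polynomial.C ((q : ℂ) ^ (2 * n) * (1 - (q : ℂ) ^ (2 * j))) * pBerPoly q n (j - 1) := by
  have hq : (q : ℂ) ≠ 0 := by exact_mod_cast hq0.ne'
  refine Polynomial.funext fun x => ?_
  simp only [Polynomial.eval_mul, Polynomial.eval_add, Polynomial.eval_sub, Polynomial.eval_C,
    Polynomial.eval_X]
  rw [eval_pBerPoly hq0 hn (show j + 1 < j + 2 by omega),
    eval_pBerPoly hq0 hn (show j < j + 2 by omega),
    eval_pBerPoly hq0 hn (show j - 1 < j + 2 by omega)]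
  have h := sum_berCoeff_contiguous hq0 hq1 hn
    (inv_ne_zero (pow_ne_zero (2 * j) hq)) ((q : ℂ) ^ (2 * n - 2) * (1 - (q : ℂ) ^ 2) ^ 2 * x) (j + 1)
  rw [show berCoeff q n (((q : ℂ) ^ (2 * j))⁻¹) (j + 1) = 0 by
    simp [berCoeff, qpochC_inv_pow_eq_zero hq0 (Nat.lt_succ_self j)], zero_div, zero_mul] at h
  rw [← sub_eq_zero, ← h]
  simp only [Finset.mul_sum, ← Finset.sum_sub_distrib]
  refine Finset.sum_congr rfl fun l _ => ?_
  have hz : ((q : ℂ) ^ (2 * j))⁻¹ / (q : ℂ) ^ 2 = ((q : ℂ) ^ (2 * (j + 1)))⁻¹ := by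
    rw [mul_add, pow_add, mul_inv]; rfl
  rw [hz]
  obtain rfl | hj := Nat.eq_zero_or_pos j
  · simp
    ring
  · have hz' : ((q : ℂ) ^ (2 * j))⁻¹ * (q : ℂ) ^ 2 = ((q : ℂ) ^ (2 * (j - 1)))⁻¹ := by
      obtain ⟨i, rfl⟩ := Nat.exists_eq_add_of_lt hj
      simp only [zero_add, Nat.add_sub_cancel, mul_add, pow_add]
      field_simp
    rw [hz']
    field_simp
    ring

/-- The scalar `q^{2jn} (q²;q²)_{n−1} / (q^{2j+2};q²)_{n−1}`. -/
noncomputable def berWeight (q : ℝ) (n j : ℕ) : ℂ :=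
  (q : ℂ) ^ (2 * j * n) * (qpochC q ((q : ℂ) ^ 2) (n - 1) /
    qpochC q ((q : ℂ) ^ (2 * j + 2)) (n - 1))

lemma berWeight_zero {q : ℝ} (hq0 : 0 < q) (hq1 : q < 1) (n : ℕ) : berWeight q n 0 = 1 := by
  simp [berWeight, div_self (qpochC_pow_ne_zero hq0 hq1 two_ne_zero (n - 1))]

lemma berWeight_succ {q : ℝ} (hq0 : 0 < q) (hq1 : q < 1) {n : ℕ} (hn : 1 ≤ n) (j : ℕ) :
    (1 - (q : ℂ) ^ (2 * n) * (q : ℂ) ^ (2 * j)) * berWeight q n (j + 1) =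
      (q : ℂ) ^ (2 * n) * (1 - (q : ℂ) ^ (2 * (j + 1))) * berWeight q n j := by
  obtain ⟨m, rfl⟩ := Nat.exists_eq_add_of_le' hn
  have h : (1 - (q : ℂ) ^ (2 * (j + 1))) * qpochC q ((q : ℂ) ^ (2 * (j + 1) + 2)) m =
      qpochC q ((q : ℂ) ^ (2 * j + 2)) m * (1 - (q : ℂ) ^ (2 * (m + 1)) * (q : ℂ) ^ (2 * j)) := by
    have := (qpochC_succ_left q ((q : ℂ) ^ (2 * (j + 1))) m).symm.trans (qpochC_succ q _ m)
    rw [← pow_add] at this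
    rw [this, mul_add_one 2 j]
    ring
  have h1 := qpochC_pow_ne_zero hq0 hq1 (k := 2 * j + 2) (by omega) m
  have h2 := qpochC_pow_ne_zero hq0 hq1 (k := 2 * (j + 1) + 2) (by omega) m
  simp only [berWeight, Nat.add_sub_cancel]
  rw [show (q : ℂ) ^ (2 * (j + 1) * (m + 1)) = (q : ℂ) ^ (2 * (m + 1)) * (q : ℂ) ^ (2 * j * (m + 1))
    by ring]
  field_simp
  linear_combination
    -((q : ℂ) ^ (2 * (m + 1)) * (q : ℂ) ^ (2 * j * (m + 1)) * qpochC q ((q : ℂ) ^ 2) m) * h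

/-- The action of the rescaled `DeltaOp` on the weighted delta functions is governed by the
recurrence of the polynomials `p_j`. -/
lemma deltaOp_berWeight_recurrence {q : ℝ} (hq0 : 0 < q) (hq1 : q < 1) {n : ℕ} (hn : 1 ≤ n)
    (j : ℕ) :
    ((q : ℂ) ^ (2 * n - 2) * (1 - (q : ℂ) ^ 2) ^ 2) •
        DeltaOp q n (berWeight q n j • fun l => if l = j then (1 : ℂ) else 0) +
      (1 + (q : ℂ) ^ (2 * n) - 2 * (q : ℂ) ^ (2 * n) * (q : ℂ) ^ (2 * j)) •
        (berWeight q n j • fun l => if l = j then (1 : ℂ) else 0) -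
      ((q : ℂ) ^ (2 * n) * (1 - (q : ℂ) ^ (2 * j))) •
        (berWeight q n (j - 1) • fun l => if l = j - 1 then (1 : ℂ) else 0) =
      (1 - (q : ℂ) ^ (2 * n) * (q : ℂ) ^ (2 * j)) •
        (berWeight q n (j + 1) • fun l => if l = j + 1 then (1 : ℂ) else 0) := by
  have hq : (q : ℂ) ≠ 0 := by exact_mod_cast hq0.ne'
  have h1 := one_sub_ofReal_pow_ne_zero hq0 hq1 two_ne_zero
  have hκ (t : ℂ) : (q : ℂ) ^ (2 * n - 2) * (1 - (q : ℂ) ^ 2) ^ 2 *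
      ((q : ℂ) ^ 2 / (1 - (q : ℂ) ^ 2) ^ 2 * t) = (q : ℂ) ^ (2 * n) * t := by
    rw [show (q : ℂ) ^ (2 * n) = (q : ℂ) ^ (2 * n - 2) * (q : ℂ) ^ 2 by
      rw [← pow_add]; congr 1; omega]
    field_simp
  have hs := berWeight_succ hq0 hq1 hn j
  have hp : (q : ℂ) ^ (2 * n) * (1 - (q : ℂ) ^ (2 * j)) * berWeight q n (j - 1) =
      if j = 0 then 0 else
        (1 - (q : ℂ) ^ (2 * n) * (q : ℂ) ^ (2 * (j - 1))) * berWeight q n j := by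
    cases j with
    | zero => simp
    | succ i => simpa using (berWeight_succ hq0 hq1 hn i).symm
  have ha := pow_ne_zero (2 * n) hq
  funext l
  simp only [Pi.add_apply, Pi.sub_apply, Pi.smul_apply, smul_eq_mul, map_smul, DeltaOp,
    LinearMap.coe_mk, AddHom.coe_mk]
  rw [← mul_assoc _ (berWeight q n (j - 1)), hp, ← mul_assoc _ (berWeight q n (j + 1)), hs,
    mul_left_comm _ (berWeight q n j), hκ]
  have hinv := mul_inv_cancel₀ ha
  rcases lt_trichotomy l j with h | rfl | h
  · by_cases h' : l + 1 = j
    · subst h'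
      have e1 : l ≠ l + 1 := by omega
      have e2 : l - 1 ≠ l + 1 := by omega
      have e3 : l ≠ l + 1 + 1 := by omega
      simp [e2, e3]
      linear_combination berWeight q n (l + 1) * hinv
    · have e0 : l ≠ j := by omega
      have e1 : l - 1 ≠ j := by omega
      have e2 : l ≠ j - 1 := by omega
      have e3 : l ≠ j + 1 := by omega
      simp [e0, e1, e2, e3, h']
  · cases l with
    | zero =>
      simp
      linear_combination -berWeight q n 0 * hinv
    | succ l =>
      simp
      linear_combination -berWeight q n (l + 1) * hinv
  · have e0 : l ≠ 0 := by omega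
    have e1 : l ≠ j := by omega
    have e2 : l + 1 ≠ j := by omega
    have e3 : l ≠ j - 1 := by omega
    by_cases h' : l = j + 1
    · subst h'
      simp [e2, e3]
      ring
    · have e4 : l - 1 ≠ j := by omega
      simp [e0, e1, e2, e3, e4, h']

lemma aeval_apply_of_recurrence {R M : Type*} [CommRing R] [AddCommGroup M] [Module R M]
    (T : Module.End R M) (v : M) {a b c d : R} {p p' p'' : Polynomial R}
    (h : Polynomial.C a * p =
      (Polynomial.C b * Polynomial.X + Polynomial.C c) * p' - Polynomial.C d * p'') :
    a • Polynomial.aeval T p v = b • T (Polynomial.aeval T p' v) + c • Polynomial.aeval T p' v -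
      d • Polynomial.aeval T p'' v := by
  simpa using congrArg (fun r => Polynomial.aeval T r v) h

/-- `p_j(Δ) δ_0 = q^{2jn} (q²;q²)_{n−1}/(q^{2j+2};q²)_{n−1} · δ_j`. -/
theorem statement10 (q : ℝ) (hq0 : 0 < q) (hq1 : q < 1) (n : ℕ) (hn : 1 ≤ n) (j : ℕ) :
    (Polynomial.aeval (DeltaOp q n) (pBerPoly q n j)) (fun l => if l = 0 then (1 : ℂ) else 0) =
      ((q : ℂ) ^ (2 * j * n) * (qpochC q ((q : ℂ) ^ 2) (n - 1) /
          qpochC q ((q : ℂ) ^ (2 * j + 2)) (n - 1))) •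
        (fun l => if l = j then (1 : ℂ) else 0) := by
  suffices h : ∀ i ≤ j, Polynomial.aeval (DeltaOp q n) (pBerPoly q n i)
      (fun l => if l = 0 then (1 : ℂ) else 0) =
        berWeight q n i • (fun l => if l = i then (1 : ℂ) else 0) from h j le_rfl
  induction j with
  | zero =>
    intro i hi
    obtain rfl := Nat.le_zero.mp hi
    rw [berWeight_zero hq0 hq1]
    simp [pBerPoly, qpochC]
  | succ j ih =>
    intro i hi
    obtain hi | rfl := Nat.le_succ_iff.mp hi
    · exact ih i hi
    have ha : 1 - (q : ℂ) ^ (2 * n) * (q : ℂ) ^ (2 * j) ≠ 0 := by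
      rw [← pow_add]
      exact one_sub_ofReal_pow_ne_zero hq0 hq1 (by omega)
    have h := aeval_apply_of_recurrence (DeltaOp q n) (fun l => if l = 0 then (1 : ℂ) else 0)
      (pBerPoly_recurrence hq0 hq1 hn j)
    rw [ih j le_rfl, ih (j - 1) (Nat.sub_le j 1)] at h
    exact smul_right_injective _ ha (h.trans (deltaOp_berWeight_recurrence hq0 hq1 hn j))
end

section
/- For every integer k ≥ 0, every t = q^{2α} ∈ (0,1), and every ρ ∈ ℝ: the series defining the q-spherical transform of B_{q,α} f_k converges absolutely and 𝓕(B_{q,α} f_k)(ρ) = b_{q,α}(ρ) · 𝓕f_k(ρ), where 𝓕f_k(ρ) = (1 − q^{2n}) q^{−2nk} (q^{2k+2};q²)_{n−1} φ_ρ(q^{2k}). That is, under the q-spherical transform the radial q-Berezin transform becomes multiplication by the function b_{q,α} (Proposition 5.1). -/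
/-- The q²-shifted factorial (real version). -/
noncomputable def qpochR (q a : ℝ) (m : ℕ) : ℝ :=
  ∏ j ∈ Finset.range m, (1 - a * q ^ (2 * j))

/-- The infinite q²-shifted factorial `(a; q²)_∞`. -/
noncomputable def qpochCInf (q : ℝ) (a : ℂ) : ℂ :=
  ∏' j : ℕ, (1 - a * (q : ℂ) ^ (2 * j))

/-- `q^z = e^{z·ln q}` for complex `z`. -/
noncomputable def qcpow (q : ℝ) (z : ℂ) : ℂ := Complex.exp (z * Real.log q)

/-- The q-spherical function `φ_ρ(q^{2m})`. -/
noncomputable def sphPhi (q : ℝ) (n : ℕ) (ρ : ℝ) (m : ℕ) : ℂ :=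
  ∑ l ∈ Finset.range (m + 1),
    qpochC q (((q : ℂ) ^ (2 * m))⁻¹) l *
      qpochC q (qcpow q ((n : ℂ) + ρ * Complex.I)) l *
      qpochC q (qcpow q ((n : ℂ) - ρ * Complex.I)) l /
      (qpochC q ((q : ℂ) ^ (2 * n)) l * qpochC q ((q : ℂ) ^ 2) l) * (q : ℂ) ^ (2 * l)

/-- The radial q-Berezin transform of the delta function `f_k`, evaluated at `q^{2j}`. -/
noncomputable def Brad (q t : ℝ) (n k j : ℕ) : ℝ :=
  t ^ (k + j) * q ^ (2 * k) * q ^ (2 * j * (n + 1)) *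
    ∑ m ∈ Finset.range (min j k + 1),
      (t ^ (2 * m))⁻¹ * (q ^ (4 * m + 2 * m * n))⁻¹ * qpochR q (t * q ^ 2) (n + m) *
        qpochR q (q ^ (2 * k - 2 * m + 2)) (n + m - 1) * qpochR q (t * q ^ (2 * n + 2)) m *
        qpochR q (q ^ (2 * j - 2 * m + 2)) m /
        (qpochR q (q ^ 2) (n + m - 1) * qpochR q (q ^ 2) m)

/-- The Berezin symbol
`b_{q,α}(ρ) = (tq²;q²)_∞ (tq^{2n+2};q²)_∞ / [(tq^{n+2+iρ};q²)_∞ (tq^{n+2−iρ};q²)_∞]`,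
`t = q^{2α}`. -/
noncomputable def bSym (q t : ℝ) (n : ℕ) (ρ : ℝ) : ℂ :=
  qpochCInf q ((t : ℂ) * (q : ℂ) ^ 2) * qpochCInf q ((t : ℂ) * (q : ℂ) ^ (2 * n + 2)) /
    (qpochCInf q ((t : ℂ) * qcpow q (((n : ℕ) : ℂ) + 2 + ρ * Complex.I)) *
      qpochCInf q ((t : ℂ) * qcpow q (((n : ℕ) : ℂ) + 2 - ρ * Complex.I)))

/-- The `p`-shifted factorial `(a; p)_m`. -/
noncomputable def qPoch (p a : ℂ) (m : ℕ) : ℂ := ∏ i ∈ Finset.range m, (1 - a * p ^ i)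

/-- The polynomial `(1 - y)(1 - y p⁻¹)⋯(1 - y p^{-(m-1)})`. -/
noncomputable def qFalling (p : ℂ) (m : ℕ) (y : ℂ) : ℂ := ∏ i ∈ Finset.range m, (1 - y / p ^ i)

/-- The terminating series `₃φ₂(p^{-m}, X, Y; p^{N+1}, 0; p, p)`. -/
noncomputable def ascPhi (p : ℂ) (N : ℕ) (X Y : ℂ) (m : ℕ) : ℂ :=
  ∑ l ∈ Finset.range (m + 1), qPoch p (p ^ m)⁻¹ l * qPoch p X l * qPoch p Y l /
    (qPoch p (p ^ (N + 1)) l * qPoch p p l) * p ^ l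

/-- The weighted polynomials `s^j (p^{j-m+1}; p)_{m+N}` into which the Berezin kernel expands. -/
noncomputable def qWeight (p : ℂ) (N : ℕ) (s : ℂ) (m j : ℕ) : ℂ :=
  s ^ j * qFalling p m (p ^ j) * qPoch p (p ^ j * p) N

/-- The adjoint of the difference operator diagonalised by `ascPhi`. -/
noncomputable def adjLap (p : ℂ) (N : ℕ) (f : ℕ → ℂ) : ℕ → ℂ
  | 0 => 2 * p ^ (N + 1) * f 0 + (1 - p) * p ^ (N + 1) * f 1
  | j + 1 => (1 - p ^ (N + 1) * p ^ j) * f j + 2 * p ^ (N + 1) * p ^ (j + 1) * f (j + 1) +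
      (1 - p ^ (j + 2)) * p ^ (N + 1) * f (j + 2)

/-- The diagonal coefficients of the expansion of the Berezin kernel. -/
noncomputable def kerCoeff (p : ℂ) (N : ℕ) (s : ℂ) (m : ℕ) : ℂ :=
  qPoch p s (N + 1 + m) * qPoch p (s * p ^ (N + 1)) m /
    (s ^ (2 * m) * (p ^ (N + 1)) ^ m * qPoch p p (N + m) * qPoch p p m)

/-- The generating series of `ascPhi` against `qWeight`. -/
noncomputable def genSeries (p : ℂ) (N : ℕ) (X Y s : ℂ) (m : ℕ) : ℂ :=
  ∑' j, qWeight p N s m j * ascPhi p N X Y j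

theorem qPoch_succ (p a : ℂ) (m : ℕ) : qPoch p a (m + 1) = qPoch p a m * (1 - a * p ^ m) :=
  Finset.prod_range_succ _ _

theorem qPoch_succ' (p a : ℂ) (m : ℕ) : qPoch p a (m + 1) = (1 - a) * qPoch p (a * p) m := by
  rw [qPoch, Finset.prod_range_succ', mul_comm]
  simp [qPoch, pow_succ', mul_assoc]

@[simp] theorem qPoch_zero (p a : ℂ) : qPoch p a 0 = 1 := rfl

theorem one_sub_pow_ne_zero {p : ℂ} (hp1 : ‖p‖ < 1) (i : ℕ) : 1 - p ^ (i + 1) ≠ 0 := by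
  intro h
  have h1 : ‖p ^ (i + 1)‖ = 1 := by rw [← sub_eq_zero.mp h, norm_one]
  rw [norm_pow] at h1
  exact absurd h1 (pow_lt_one₀ (norm_nonneg _) hp1 (by simp)).ne

theorem qPoch_pow_ne_zero {p : ℂ} (hp1 : ‖p‖ < 1) (N m : ℕ) : qPoch p (p ^ (N + 1)) m ≠ 0 := by
  refine Finset.prod_ne_zero_iff.mpr fun i _ => ?_
  rw [← pow_add, show N + 1 + i = N + i + 1 by ring]
  exact one_sub_pow_ne_zero hp1 _

theorem qPoch_self_ne_zero {p : ℂ} (hp1 : ‖p‖ < 1) (m : ℕ) : qPoch p p m ≠ 0 := by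
  simpa using qPoch_pow_ne_zero hp1 0 m

theorem qPoch_inv_pow_eq_zero {p : ℂ} (hp0 : p ≠ 0) {m l : ℕ} (h : m < l) :
    qPoch p (p ^ m)⁻¹ l = 0 :=
  Finset.prod_eq_zero (Finset.mem_range.mpr h) (by field_simp; simp)

theorem qFalling_succ (p y : ℂ) (m : ℕ) :
    qFalling p (m + 1) y = qFalling p m y * (1 - y / p ^ m) :=
  Finset.prod_range_succ _ _

theorem qFalling_succ_mul {p : ℂ} (hp0 : p ≠ 0) (m : ℕ) (y : ℂ) :
    qFalling p (m + 1) (p * y) = (1 - p * y) * qFalling p m y := by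
  rw [qFalling, Finset.prod_range_succ', mul_comm]
  congr 1
  · simp
  · refine Finset.prod_congr rfl fun i _ => ?_
    rw [pow_succ', mul_div_mul_left _ _ hp0]

theorem qFalling_pow_eq_zero {p : ℂ} (hp0 : p ≠ 0) {m j : ℕ} (h : j < m) :
    qFalling p m (p ^ j) = 0 :=
  Finset.prod_eq_zero (Finset.mem_range.mpr h) (by field_simp; simp)

theorem ascPhi_eq_sum {p : ℂ} (hp0 : p ≠ 0) (N : ℕ) (X Y : ℂ) {m M : ℕ} (h : m < M) :
    ascPhi p N X Y m = ∑ l ∈ Finset.range M, qPoch p (p ^ m)⁻¹ l * qPoch p X l * qPoch p Y l /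
      (qPoch p (p ^ (N + 1)) l * qPoch p p l) * p ^ l := by
  refine Finset.sum_subset (Finset.range_mono h) fun l _ hl => ?_
  rw [qPoch_inv_pow_eq_zero hp0 (by simpa using hl)]
  simp

/-- The three-term recurrence of `ascPhi`. -/
theorem ascPhi_recurrence {p : ℂ} (hp0 : p ≠ 0) (hp1 : ‖p‖ < 1) {N : ℕ} {X Y : ℂ}
    (hXY : X * Y = p ^ (N + 1)) (m : ℕ) :
    (X + Y) * ascPhi p N X Y m = (1 - p ^ (N + 1) * p ^ m) * ascPhi p N X Y (m + 1) +
      2 * p ^ (N + 1) * p ^ m * ascPhi p N X Y m +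
      (1 - p ^ m) * p ^ (N + 1) * ascPhi p N X Y (m - 1) := by
  set c : ℕ → ℕ → ℂ := fun m l => qPoch p (p ^ m)⁻¹ l * qPoch p X l * qPoch p Y l /
    (qPoch p (p ^ (N + 1)) l * qPoch p p l) * p ^ l with hc
  have key : ∀ M, ∑ l ∈ Finset.range (M + 1), ((X + Y) * c m l -
      ((1 - p ^ (N + 1) * p ^ m) * c (m + 1) l + 2 * p ^ (N + 1) * p ^ m * c m l +
      (1 - p ^ m) * p ^ (N + 1) * c (m - 1) l)) =
      -(qPoch p (p ^ m)⁻¹ M * qPoch p X (M + 1) * qPoch p Y (M + 1) /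
        (qPoch p (p ^ (N + 1)) M * qPoch p p M)) := by
    intro M
    induction M with
    | zero =>
      simp [hc, qPoch_succ]
      linear_combination hXY
    | succ M ih =>
      rw [Finset.sum_range_succ, ih]
      have h1 : qPoch p (p ^ (m + 1))⁻¹ (M + 1) =
          (1 - (p ^ (m + 1))⁻¹) * qPoch p (p ^ m)⁻¹ M := by
        rw [qPoch_succ', pow_succ]
        congr 2
        field_simp
      have h2 : (1 - p ^ m) * qPoch p (p ^ (m - 1))⁻¹ (M + 1) =
          -p ^ m * (qPoch p (p ^ m)⁻¹ M * (1 - (p ^ m)⁻¹ * p ^ M) *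
            (1 - (p ^ m)⁻¹ * p ^ (M + 1))) := by
        rw [← qPoch_succ, ← qPoch_succ, qPoch_succ' p (p ^ m)⁻¹]
        rcases m with _ | m
        · simp
        · have : (p ^ (m + 1))⁻¹ * p = (p ^ (m + 1 - 1))⁻¹ := by
            rw [Nat.add_sub_cancel, pow_succ]; field_simp
          rw [this]
          field_simp
          ring
      have hP := qPoch_pow_ne_zero hp1 N M
      have hq := qPoch_self_ne_zero hp1 M
      have hP' := qPoch_pow_ne_zero hp1 N (M + 1)
      have hq' := qPoch_self_ne_zero hp1 (M + 1)
      have h3 : (1 - p ^ m) * p ^ (N + 1) * c (m - 1) (M + 1) =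
        ((1 - p ^ m) * qPoch p (p ^ (m - 1))⁻¹ (M + 1)) * (p ^ (N + 1) *
          (qPoch p X (M + 1) * qPoch p Y (M + 1) /
    (qPoch p (p ^ (N + 1)) (M + 1) * qPoch p p (M + 1)) * p ^ (M + 1))) := by
        simp only [hc]; ring
      rw [h3, h2]
      simp only [hc]
      rw [h1]
      rw [qPoch_succ] at hP' hq'
      have hP2 := right_ne_zero_of_mul hP'
      have hq2 := right_ne_zero_of_mul hq'
      rw [qPoch_succ _ X (M + 1), qPoch_succ _ Y (M + 1), qPoch_succ _ (p ^ m)⁻¹ M,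
        qPoch_succ _ (p ^ (N + 1)) M, qPoch_succ _ p M]
      have hY : qPoch p X (M + 1) * qPoch p Y (M + 1) * ((1 - X * p ^ (M + 1)) * (1 - Y * p ^ (M + 1)))
        = qPoch p X (M + 1) * qPoch p Y (M + 1) * (1 - (X + Y) * p ^ (M + 1) +
          p ^ (N + 1) * p ^ (M + 1) * p ^ (M + 1)) := by rw [← hXY]; ring
      generalize qPoch p X (M + 1) = A at *
      generalize qPoch p Y (M + 1) = B at *
      rw [show ∀ Z : ℂ, Z * (A * (1 - X * p ^ (M + 1))) * (B * (1 - Y * p ^ (M + 1))) =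
        Z * (A * B * ((1 - X * p ^ (M + 1)) * (1 - Y * p ^ (M + 1)))) from fun Z => by ring, hY]
      generalize p ^ (N + 1) = P at *
      generalize X + Y = K at *
      generalize qPoch p (p ^ m)⁻¹ M = E at *
      generalize qPoch p P M = D at *
      generalize qPoch p p M = F at *
      simp only [pow_succ] at *
      have hpm : p ^ m ≠ 0 := pow_ne_zero _ hp0
      generalize p ^ m = z at *
      generalize p ^ M = w at *
      clear h1 h2 h3 hY ih hc hP' hq'
      generalize hU : 1 - P * w = U at *
      generalize hV : 1 - p * w = V at *
      field_simp
      rw [← hU, ← hV]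
      ring
  have h := key (m + 1)
  rw [qPoch_inv_pow_eq_zero hp0 (Nat.lt_succ_self m)] at h
  simp only [Finset.sum_sub_distrib, Finset.sum_add_distrib, ← Finset.mul_sum] at h
  rw [ascPhi_eq_sum hp0 N X Y (show m < m + 1 + 1 by omega),
    ascPhi_eq_sum hp0 N X Y (show m + 1 < m + 1 + 1 by omega),
    ascPhi_eq_sum hp0 N X Y (show m - 1 < m + 1 + 1 by omega)]
  simp only [zero_mul, zero_div, neg_zero] at h
  exact sub_eq_zero.mp h

/-- Raising coefficient of `adjLap` on `qWeight`. -/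
noncomputable def raiseCoeff (p : ℂ) (N : ℕ) (s : ℂ) (m : ℕ) : ℂ :=
  s⁻¹ * (1 - s * p ^ (N + 1) * p ^ m) ^ 2

/-- Lowering coefficient of `adjLap` on `qWeight`. -/
noncomputable def lowerCoeff (p : ℂ) (N : ℕ) (s : ℂ) (m : ℕ) : ℂ :=
  p ^ (N + 1) * s * (1 - p ^ (N + m)) * (1 - p ^ m)

/-- Diagonal coefficient of `adjLap` on `qWeight`. -/
noncomputable def diagCoeff (p : ℂ) (N : ℕ) (s : ℂ) (m : ℕ) : ℂ :=
  p ^ (N + 1) * s - lowerCoeff p N s m + 2 * p ^ (N + 1) * p ^ m -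
    s * (p ^ (N + 1)) ^ 2 * (p ^ m) ^ 2

theorem qFalling_contiguous {p s : ℂ} (hp0 : p ≠ 0) (hs : s ≠ 0) (N m : ℕ) (y : ℂ) :
    s⁻¹ * qFalling p (m + 1) y + 2 * p ^ (N + 1) * y * qFalling p m y +
        s * p ^ (N + 1) * (1 - p ^ (N + 1) * y) * qFalling p m (p * y) =
      raiseCoeff p N s m * qFalling p (m + 1) y + diagCoeff p N s m * qFalling p m y +
        lowerCoeff p N s m * qFalling p (m - 1) y := by
  rcases m with _ | m
  · simp only [raiseCoeff, diagCoeff, lowerCoeff, qFalling, Finset.prod_range_succ,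
      Finset.prod_range_zero]
    field_simp
    ring
  · rw [qFalling_succ_mul hp0, qFalling_succ, qFalling_succ, Nat.add_sub_cancel, raiseCoeff,
      diagCoeff, lowerCoeff, show N + (m + 1) = N + 1 + m by ring]
    simp only [pow_succ, pow_add]
    have h1 : p ^ m ≠ 0 := pow_ne_zero _ hp0
    field_simp
    ring

theorem qPoch_shift (p y : ℂ) (N : ℕ) :
    (1 - p * y) * qPoch p (p * y * p) N = (1 - p ^ (N + 1) * y) * qPoch p (y * p) N := by
  rw [mul_comm p y, ← qPoch_succ', qPoch_succ]
  ring

/-- `adjLap` acts tridiagonally on `qWeight`. -/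
theorem adjLap_qWeight {p s : ℂ} (hp0 : p ≠ 0) (hs : s ≠ 0) (N m j : ℕ) :
    adjLap p N (qWeight p N s m) j = raiseCoeff p N s m * qWeight p N s (m + 1) j +
      diagCoeff p N s m * qWeight p N s m j + lowerCoeff p N s m * qWeight p N s (m - 1) j := by
  have hc := qFalling_contiguous hp0 hs N m (p ^ j)
  have hsh := qPoch_shift p (p ^ j) N
  have main : s⁻¹ * s ^ j * qFalling p (m + 1) (p ^ j) * qPoch p (p ^ j * p) N +
      2 * p ^ (N + 1) * p ^ j * qWeight p N s m j +
      (1 - p ^ (j + 1)) * p ^ (N + 1) * qWeight p N s m (j + 1) =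
      raiseCoeff p N s m * qWeight p N s (m + 1) j +
      diagCoeff p N s m * qWeight p N s m j + lowerCoeff p N s m * qWeight p N s (m - 1) j := by
    simp only [qWeight, pow_succ' p j]
    linear_combination s ^ j * qPoch p (p ^ j * p) N * hc +
      p ^ (N + 1) * s ^ (j + 1) * qFalling p m (p * p ^ j) * hsh
  rw [← main]
  rcases j with _ | j
  · simp only [adjLap]
    rw [qFalling_pow_eq_zero hp0 (Nat.succ_pos m)]
    simp
  · simp only [adjLap]
    have hsh' := qPoch_shift p (p ^ j) N
    rw [pow_succ' p j, qFalling_succ_mul hp0]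
    have hss : s⁻¹ * s ^ (j + 1) = s ^ j := by rw [pow_succ]; field_simp
    rw [hss]
    simp only [qWeight]
    rw [pow_succ' p (j + 1), pow_succ' p j]
    linear_combination -s ^ j * qFalling p m (p ^ j) * hsh'

theorem kerCoeff_balance {p s : ℂ} (hp0 : p ≠ 0) (hp1 : ‖p‖ < 1) (hs : s ≠ 0) (N m : ℕ) :
    kerCoeff p N s (m + 1) * lowerCoeff p N s (m + 1) =
      kerCoeff p N s m * raiseCoeff p N s m := by
  have h1 := qPoch_self_ne_zero hp1 (N + m)
  have h2 := qPoch_self_ne_zero hp1 m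
  have h3 := one_sub_pow_ne_zero hp1 (N + m)
  have h4 := one_sub_pow_ne_zero hp1 m
  have h5 : p ^ (N + 1) ≠ 0 := pow_ne_zero _ hp0
  simp only [kerCoeff, raiseCoeff, lowerCoeff, ← add_assoc, qPoch_succ]
  rw [show p * p ^ (N + m) = p ^ (N + m + 1) by ring, show p * p ^ m = p ^ (m + 1) by ring,
    show s * p ^ (N + 1 + m) = s * p ^ (N + 1) * p ^ m by ring]
  generalize 1 - p ^ (N + m + 1) = U at *
  generalize 1 - p ^ (m + 1) = V at *
  generalize p ^ (N + 1) = P at *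
  field_simp
  ring

theorem sum_adjLap_qWeight {p s : ℂ} (hp0 : p ≠ 0) (hp1 : ‖p‖ < 1) (hs : s ≠ 0) (N k : ℕ)
    (G : ℕ → ℂ) (K : ℂ)
    (hG : ∀ m, K * G m = raiseCoeff p N s m * G (m + 1) + diagCoeff p N s m * G m +
      lowerCoeff p N s m * G (m - 1)) (M : ℕ) :
    ∑ m ∈ Finset.range (M + 1), kerCoeff p N s m * (K * qWeight p N s m k * G m -
        adjLap p N (qWeight p N s m) k * G m) =
      kerCoeff p N s M * raiseCoeff p N s M *
        (qWeight p N s M k * G (M + 1) - qWeight p N s (M + 1) k * G M) := by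
  have step : ∀ m, K * qWeight p N s m k * G m - adjLap p N (qWeight p N s m) k * G m =
      raiseCoeff p N s m * (qWeight p N s m k * G (m + 1) - qWeight p N s (m + 1) k * G m) +
      lowerCoeff p N s m * (qWeight p N s m k * G (m - 1) - qWeight p N s (m - 1) k * G m) := by
    intro m
    rw [adjLap_qWeight hp0 hs]
    linear_combination qWeight p N s m k * hG m
  induction M with
  | zero =>
    simp [step, lowerCoeff]
    ring
  | succ M ih =>
    rw [Finset.sum_range_succ, ih, step, mul_add, ← mul_assoc _ (lowerCoeff p N s (M + 1)),
      kerCoeff_balance hp0 hp1 hs, Nat.add_sub_cancel]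
    ring

/-- The kernel sum applied to a sequence `G`, in the variable `k`. -/
noncomputable def kerSum (p : ℂ) (N : ℕ) (s : ℂ) (G : ℕ → ℂ) (k : ℕ) : ℂ :=
  ∑ m ∈ Finset.range (k + 1), kerCoeff p N s m * qWeight p N s m k * G m

theorem kerSum_eq_sum {p : ℂ} (hp0 : p ≠ 0) (N : ℕ) (s : ℂ) (G : ℕ → ℂ) {k M : ℕ} (h : k < M) :
    kerSum p N s G k = ∑ m ∈ Finset.range M, kerCoeff p N s m * qWeight p N s m k * G m := by
  refine Finset.sum_subset (Finset.range_mono h) fun m _ hm => ?_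
  rw [qWeight, qFalling_pow_eq_zero hp0 (by simpa using hm)]
  simp

theorem adjLap_kerSum {p s : ℂ} (hp0 : p ≠ 0) (hp1 : ‖p‖ < 1) (hs : s ≠ 0) (N : ℕ)
    (G : ℕ → ℂ) (K : ℂ)
    (hG : ∀ m, K * G m = raiseCoeff p N s m * G (m + 1) + diagCoeff p N s m * G m +
      lowerCoeff p N s m * G (m - 1)) (k : ℕ) :
    adjLap p N (kerSum p N s G) k = K * kerSum p N s G k := by
  have h := sum_adjLap_qWeight hp0 hp1 hs N k G K hG (k + 1)
  have hz : ∀ m, k < m → qWeight p N s m k = 0 := fun m hm => by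
    rw [qWeight, qFalling_pow_eq_zero hp0 hm]; simp
  rw [hz _ (Nat.lt_succ_self k), hz (k + 1 + 1) (by omega)] at h
  rw [eq_comm, ← sub_eq_zero]
  rw [zero_mul, zero_mul, sub_zero, mul_zero] at h
  rw [← h]
  rcases k with _ | k
  · simp only [adjLap]
    rw [kerSum_eq_sum hp0 N s G (show 0 < 0 + 1 + 1 by omega),
      kerSum_eq_sum hp0 N s G (show 1 < 0 + 1 + 1 by omega)]
    simp only [Finset.mul_sum, ← Finset.sum_sub_distrib, ← Finset.sum_add_distrib]
    exact Finset.sum_congr rfl fun m _ => by ring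
  · simp only [adjLap]
    rw [kerSum_eq_sum hp0 N s G (show k < k + 1 + 1 + 1 by omega),
      kerSum_eq_sum hp0 N s G (show k + 1 < k + 1 + 1 + 1 by omega),
      kerSum_eq_sum hp0 N s G (show k + 2 < k + 1 + 1 + 1 by omega)]
    simp only [Finset.mul_sum, ← Finset.sum_sub_distrib, ← Finset.sum_add_distrib]
    exact Finset.sum_congr rfl fun m _ => by ring

theorem adjLap_eigen_unique {p : ℂ} (hp0 : p ≠ 0) (hp1 : ‖p‖ < 1) (N : ℕ) {f g : ℕ → ℂ} {K : ℂ}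
    (hf : ∀ k, adjLap p N f k = K * f k) (hg : ∀ k, adjLap p N g k = K * g k)
    (h0 : f 0 = g 0) (k : ℕ) : f k = g k := by
  have hP : p ^ (N + 1) ≠ 0 := pow_ne_zero _ hp0
  have hne := fun i => mul_ne_zero (one_sub_pow_ne_zero hp1 i) hP
  have h1 : f 1 = g 1 := by
    have hf0 := hf 0
    have hg0 := hg 0
    simp only [adjLap] at hf0 hg0
    refine mul_left_cancel₀ (hne 0) ?_
    rw [h0] at hf0
    linear_combination hf0 - hg0
  have h : ∀ k, f k = g k ∧ f (k + 1) = g (k + 1) := by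
    intro k
    induction k with
    | zero => exact ⟨h0, h1⟩
    | succ k ih =>
      refine ⟨ih.2, mul_left_cancel₀ (hne (k + 1)) ?_⟩
      have hf0 := hf (k + 1)
      have hg0 := hg (k + 1)
      simp only [adjLap, ih.1, ih.2] at hf0 hg0
      linear_combination hf0 - hg0
  exact (h k).1

theorem adjLap_weighted_ascPhi {p : ℂ} (hp0 : p ≠ 0) (hp1 : ‖p‖ < 1) {N : ℕ} {X Y : ℂ}
    (hXY : X * Y = p ^ (N + 1)) (k : ℕ) :
    adjLap p N (fun k => ((p ^ (N + 1)) ^ k)⁻¹ * qPoch p (p ^ k * p) N * ascPhi p N X Y k) k =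
      (X + Y) * (((p ^ (N + 1)) ^ k)⁻¹ * qPoch p (p ^ k * p) N * ascPhi p N X Y k) := by
  have hP : p ^ (N + 1) ≠ 0 := pow_ne_zero _ hp0
  have hr := ascPhi_recurrence hp0 hp1 hXY k
  have hsh := qPoch_shift p (p ^ k) N
  have e1 : (1 - p ^ (k + 1)) * p ^ (N + 1) * (((p ^ (N + 1)) ^ (k + 1))⁻¹ *
      qPoch p (p ^ (k + 1) * p) N * ascPhi p N X Y (k + 1)) = ((p ^ (N + 1)) ^ k)⁻¹ *
      qPoch p (p ^ k * p) N * ((1 - p ^ (N + 1) * p ^ k) * ascPhi p N X Y (k + 1)) := by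
    rw [pow_succ (p ^ (N + 1)) k, pow_succ' p k]
    have : p ^ (N + 1) * ((p ^ (N + 1)) ^ k * p ^ (N + 1))⁻¹ = ((p ^ (N + 1)) ^ k)⁻¹ := by
      field_simp
    linear_combination (1 - p * p ^ k) * qPoch p (p * p ^ k * p) N * ascPhi p N X Y (k + 1) *
      this + ((p ^ (N + 1)) ^ k)⁻¹ * ascPhi p N X Y (k + 1) * hsh
  rcases k with _ | k
  · simp only [adjLap]
    simp only [zero_add, pow_one] at e1 ⊢
    rw [e1]
    simp only [pow_zero, sub_self, zero_mul, mul_one, add_zero] at hr ⊢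
    linear_combination -qPoch p (1 * p) N * hr
  · simp only [adjLap]
    rw [show k + 2 = k + 1 + 1 from rfl, e1]
    have hsh' := qPoch_shift p (p ^ k) N
    have e2 : ((p ^ (N + 1)) ^ k)⁻¹ = ((p ^ (N + 1)) ^ (k + 1))⁻¹ * p ^ (N + 1) := by
      rw [pow_succ _ k, mul_inv, inv_mul_cancel_right₀ hP]
    rw [e2]
    rw [Nat.add_sub_cancel] at hr
    have hsh2 : (1 - p ^ (k + 1)) * qPoch p (p ^ (k + 1) * p) N =
      (1 - p ^ (N + 1) * p ^ k) * qPoch p (p ^ k * p) N := by rw [pow_succ' p k]; exact hsh'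
    linear_combination -((p ^ (N + 1)) ^ (k + 1))⁻¹ * qPoch p (p ^ (k + 1) * p) N * hr -
      ((p ^ (N + 1)) ^ (k + 1))⁻¹ * p ^ (N + 1) * ascPhi p N X Y k * hsh2

open Filter Topology

/-- A coupled linear recursion with asymptotically contracting coefficients stays bounded. -/
theorem exists_bound_of_coupled_recurrence {u d α β : ℕ → ℂ} {X Y : ℂ} (hX : ‖X‖ < 1)
    (hY : ‖Y‖ < 1) (hu : ∀ j, u (j + 1) = X * u j + d j)
    (hd : ∀ j, d (j + 1) = α j * d j + β j * u j)
    (hα : Tendsto α atTop (𝓝 Y)) (hβ : Tendsto β atTop (𝓝 0)) : ∃ C, ∀ j, ‖u j‖ ≤ C := by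
  set L : ℝ := 2 / (1 - ‖Y‖) with hL
  have hYpos : 0 < 1 - ‖Y‖ := sub_pos.mpr hY
  have hLpos : 0 < L := div_pos two_pos hYpos
  have e1 : ∀ᶠ j in atTop, ‖α j‖ < (1 + ‖Y‖) / 2 :=
    hα.norm.eventually (gt_mem_nhds (by linarith))
  have e2 : ∀ᶠ j in atTop, ‖β j‖ < (1 - ‖X‖) / L :=
    hβ.norm.eventually (gt_mem_nhds (by simpa using div_pos (sub_pos.mpr hX) hLpos))
  obtain ⟨J, hJ⟩ := (e1.and e2).exists_forall_of_atTop
  have hmono : ∀ i, L * ‖d (J + i)‖ + ‖u (J + i)‖ ≤ L * ‖d J‖ + ‖u J‖ := by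
    intro i
    induction i with
    | zero => simp
    | succ i ih =>
      refine le_trans ?_ ih
      obtain ⟨h1, h2⟩ := hJ (J + i) (by omega)
      have hd1 : ‖d (J + i + 1)‖ ≤ ‖α (J + i)‖ * ‖d (J + i)‖ + ‖β (J + i)‖ * ‖u (J + i)‖ := by
        rw [hd]; exact (norm_add_le _ _).trans (by simp)
      have hu1 : ‖u (J + i + 1)‖ ≤ ‖X‖ * ‖u (J + i)‖ + ‖d (J + i)‖ := by
        rw [hu]; exact (norm_add_le _ _).trans (by simp)
      have h3 : L * ‖β (J + i)‖ ≤ 1 - ‖X‖ := by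
        rw [mul_comm]; exact ((lt_div_iff₀ hLpos).mp h2).le
      have h4 : L * ‖α (J + i)‖ + 1 ≤ L := by
        have : L * ((1 + ‖Y‖) / 2) + 1 = L := by rw [hL]; field_simp; ring
        nlinarith
      rw [← add_assoc J i 1]
      nlinarith [mul_le_mul_of_nonneg_left hd1 hLpos.le,
        mul_le_mul_of_nonneg_right h3 (norm_nonneg (u (J + i))),
        mul_le_mul_of_nonneg_right h4 (norm_nonneg (d (J + i)))]
  refine ⟨(L * ‖d J‖ + ‖u J‖) + ∑ i ∈ Finset.range J, ‖u i‖, fun j => ?_⟩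
  rcases lt_or_ge j J with h | h
  · have := Finset.single_le_sum (f := fun i => ‖u i‖) (fun i _ => norm_nonneg _)
      (Finset.mem_range.mpr h)
    have h0 : 0 ≤ L * ‖d J‖ + ‖u J‖ := by positivity
    linarith
  · obtain ⟨i, rfl⟩ := Nat.exists_eq_add_of_le h
    have h0 : 0 ≤ ∑ i ∈ Finset.range J, ‖u i‖ := Finset.sum_nonneg fun _ _ => norm_nonneg _
    have h1 : 0 ≤ L * ‖d (J + i)‖ := by positivity
    linarith [hmono i]

theorem ascPhi_bounded {p : ℂ} (hp0 : p ≠ 0) (hp1 : ‖p‖ < 1) {N : ℕ} {X Y : ℂ}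
    (hXY : X * Y = p ^ (N + 1)) (hX : ‖X‖ < 1) (hY : ‖Y‖ < 1) :
    ∃ C, ∀ j, ‖ascPhi p N X Y j‖ ≤ C := by
  have hpt : Tendsto (fun j : ℕ => p ^ (N + 1) * p ^ (j + 1)) atTop (𝓝 0) := by
    simpa using ((tendsto_pow_atTop_nhds_zero_of_norm_lt_one hp1).comp
      (tendsto_add_atTop_nat 1)).const_mul (p ^ (N + 1))
  have hne : ∀ j : ℕ, 1 - p ^ (N + 1) * p ^ (j + 1) ≠ 0 := fun j => by
    rw [← pow_add, show N + 1 + (j + 1) = N + 1 + j + 1 by ring]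
    exact one_sub_pow_ne_zero hp1 _
  have hinv : Tendsto (fun j : ℕ => (1 - p ^ (N + 1) * p ^ (j + 1))⁻¹) atTop (𝓝 1) := by
    simpa using (hpt.const_sub 1).inv₀ (by simp)
  refine exists_bound_of_coupled_recurrence (u := ascPhi p N X Y)
    (d := fun j => ascPhi p N X Y (j + 1) - X * ascPhi p N X Y j)
    (α := fun j => (Y + p ^ (N + 1) * p ^ (j + 1) * (X - 2)) *
      (1 - p ^ (N + 1) * p ^ (j + 1))⁻¹)
    (β := fun j => p ^ (N + 1) * p ^ (j + 1) * (X - 1) ^ 2 *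
      (1 - p ^ (N + 1) * p ^ (j + 1))⁻¹) hX hY (fun j => by ring) (fun j => ?_) ?_ ?_
  · have h := ascPhi_recurrence hp0 hp1 hXY (j + 1)
    rw [Nat.add_sub_cancel] at h
    refine mul_left_cancel₀ (hne j) ?_
    have h1 := mul_inv_cancel₀ (hne j)
    generalize (1 - p ^ (N + 1) * p ^ (j + 1))⁻¹ = I at *
    linear_combination -h + ascPhi p N X Y j * hXY -
      ((Y + p ^ (N + 1) * p ^ (j + 1) * (X - 2)) *
        (ascPhi p N X Y (j + 1) - X * ascPhi p N X Y j) +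
      p ^ (N + 1) * p ^ (j + 1) * (X - 1) ^ 2 * ascPhi p N X Y j) * h1
  · simpa using ((hpt.mul_const (X - 2)).const_add Y).mul hinv
  · simpa using (hpt.mul_const ((X - 1) ^ 2)).mul hinv

theorem qWeight_bound {p s : ℂ} (hp1 : ‖p‖ < 1) (N m : ℕ) :
    ∃ C, ∀ j, ‖qWeight p N s m j‖ ≤ C * ‖s‖ ^ j := by
  have hpj : ∀ j : ℕ, ‖p ^ j‖ ≤ 1 := fun j => by
    rw [norm_pow]; exact pow_le_one₀ (norm_nonneg _) hp1.le
  refine ⟨(∏ i ∈ Finset.range m, (1 + ‖(p ^ i)⁻¹‖)) * ∏ _i ∈ Finset.range N, 2, fun j => ?_⟩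
  have h1 : ‖qFalling p m (p ^ j)‖ ≤ ∏ i ∈ Finset.range m, (1 + ‖(p ^ i)⁻¹‖) := by
    rw [qFalling, norm_prod]
    refine Finset.prod_le_prod (fun _ _ => norm_nonneg _) fun i _ => ?_
    refine (norm_sub_le _ _).trans ?_
    rw [norm_one, div_eq_mul_inv, norm_mul]
    gcongr
    exact mul_le_of_le_one_left (norm_nonneg _) (hpj j)
  have h2 : ‖qPoch p (p ^ j * p) N‖ ≤ ∏ _i ∈ Finset.range N, 2 := by
    rw [qPoch, norm_prod]
    refine Finset.prod_le_prod (fun _ _ => norm_nonneg _) fun i _ => ?_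
    refine (norm_sub_le _ _).trans ?_
    rw [norm_one, ← pow_succ, ← pow_add]
    linarith [hpj (j + 1 + i)]
  rw [qWeight, norm_mul, norm_mul, norm_pow]
  calc ‖s‖ ^ j * ‖qFalling p m (p ^ j)‖ * ‖qPoch p (p ^ j * p) N‖
      ≤ ‖s‖ ^ j * (∏ i ∈ Finset.range m, (1 + ‖(p ^ i)⁻¹‖)) * ∏ _i ∈ Finset.range N, 2 := by
        gcongr
    _ = _ := by ring

theorem summable_qWeight_mul {p s : ℂ} (hp1 : ‖p‖ < 1) (hs1 : ‖s‖ < 1) (N m : ℕ) {g : ℕ → ℂ}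
    (hg : ∃ C, ∀ j, ‖g j‖ ≤ C) : Summable fun j => ‖qWeight p N s m j * g j‖ := by
  obtain ⟨C, hC⟩ := qWeight_bound (s := s) hp1 N m
  obtain ⟨D, hD⟩ := hg
  refine Summable.of_nonneg_of_le (fun _ => norm_nonneg _) (fun j => ?_)
    ((summable_geometric_of_lt_one (norm_nonneg s) hs1).mul_left (C * D))
  rw [norm_mul]
  calc ‖qWeight p N s m j‖ * ‖g j‖ ≤ (C * ‖s‖ ^ j) * D :=
        mul_le_mul (hC j) (hD j) (norm_nonneg _) ((norm_nonneg _).trans (hC j))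
    _ = _ := by ring

theorem tendsto_qWeight {p s : ℂ} (hp1 : ‖p‖ < 1) (hs1 : ‖s‖ < 1) (N m : ℕ) :
    Tendsto (qWeight p N s m) atTop (𝓝 0) := by
  have := (summable_qWeight_mul hp1 hs1 N m (g := fun _ => 1) ⟨1, by simp⟩).of_norm
  simpa using this.tendsto_atTop_zero

/-- Summation by parts on an initial segment. -/
theorem sum_adjLap_mul_ascPhi {p : ℂ} (hp0 : p ≠ 0) (hp1 : ‖p‖ < 1) {N : ℕ} {X Y : ℂ}
    (hXY : X * Y = p ^ (N + 1)) (f : ℕ → ℂ) (M : ℕ) :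
    ∑ j ∈ Finset.range (M + 1),
        ((X + Y) * (f j * ascPhi p N X Y j) - adjLap p N f j * ascPhi p N X Y j) =
      (1 - p ^ (N + 1) * p ^ M) * (f M * ascPhi p N X Y (M + 1)) -
        (1 - p ^ (M + 1)) * p ^ (N + 1) * (f (M + 1) * ascPhi p N X Y M) := by
  induction M with
  | zero =>
    have h := ascPhi_recurrence hp0 hp1 hXY 0
    simp only [pow_zero, sub_self, zero_mul, add_zero] at h
    simp only [zero_add, Finset.range_one, Finset.sum_singleton, adjLap]
    linear_combination f 0 * h
  | succ M ih =>
    have h := ascPhi_recurrence hp0 hp1 hXY (M + 1)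
    rw [Nat.add_sub_cancel] at h
    rw [Finset.sum_range_succ, ih]
    simp only [adjLap]
    linear_combination f (M + 1) * h

theorem genSeries_recurrence {p s : ℂ} (hp0 : p ≠ 0) (hp1 : ‖p‖ < 1) (hs : s ≠ 0)
    (hs1 : ‖s‖ < 1) {N : ℕ} {X Y : ℂ} (hXY : X * Y = p ^ (N + 1)) (hX : ‖X‖ < 1) (hY : ‖Y‖ < 1)
    (m : ℕ) :
    (X + Y) * genSeries p N X Y s m = raiseCoeff p N s m * genSeries p N X Y s (m + 1) +
      diagCoeff p N s m * genSeries p N X Y s m +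
      lowerCoeff p N s m * genSeries p N X Y s (m - 1) := by
  have hb := ascPhi_bounded hp0 hp1 hXY hX hY
  have hsum := fun m => (summable_qWeight_mul hp1 hs1 N m hb).of_norm.hasSum
  have h1 := ((hsum m).mul_left (X + Y)).sub ((((hsum (m + 1)).mul_left (raiseCoeff p N s m)).add
    ((hsum m).mul_left (diagCoeff p N s m))).add
    ((hsum (m - 1)).mul_left (lowerCoeff p N s m)))
  have h2 := (tendsto_add_atTop_iff_nat 1).mpr h1.tendsto_sum_nat
  have h3 : Tendsto (fun M : ℕ => (1 - p ^ (N + 1) * p ^ M) *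
      (qWeight p N s m M * ascPhi p N X Y (M + 1)) -
        (1 - p ^ (M + 1)) * p ^ (N + 1) * (qWeight p N s m (M + 1) * ascPhi p N X Y M))
      atTop (𝓝 0) := by
    obtain ⟨C, hC⟩ := hb
    have hw := tendsto_qWeight hp1 hs1 N m
    have hpt := tendsto_pow_atTop_nhds_zero_of_norm_lt_one hp1
    have hbd : ∀ e : ℕ, IsBoundedUnder (· ≤ ·) atTop
        (norm ∘ fun M => ascPhi p N X Y (M + e)) := fun e =>
      isBoundedUnder_of ⟨C, fun M => hC _⟩
    have a1 := hw.zero_mul_isBoundedUnder_le (hbd 1)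
    have a2 := (hw.comp (tendsto_add_atTop_nat 1)).zero_mul_isBoundedUnder_le (hbd 0)
    simpa using ((hpt.const_mul (p ^ (N + 1))).const_sub 1 |>.mul a1).sub
      ((((hpt.comp (tendsto_add_atTop_nat 1)).const_sub 1).mul_const (p ^ (N + 1))).mul a2)
  have h4 := tendsto_nhds_unique h2 (h3.congr fun M => ?_)
  · exact sub_eq_zero.mp h4
  · rw [← sum_adjLap_mul_ascPhi hp0 hp1 hXY]
    refine Finset.sum_congr rfl fun j _ => ?_
    rw [adjLap_qWeight hp0 hs]
    ring

theorem genSeries_zero_shift {p s : ℂ} (hp0 : p ≠ 0) (hp1 : ‖p‖ < 1) (hs : s ≠ 0)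
    (hs1 : ‖s‖ < 1) {N : ℕ} {X Y : ℂ} (hXY : X * Y = p ^ (N + 1)) (hX : ‖X‖ < 1) (hY : ‖Y‖ < 1) :
    (1 - s * X) * (1 - s * Y) * genSeries p N X Y s 0 =
      (1 - s * p ^ (N + 1)) ^ 2 * genSeries p N X Y (s * p) 0 := by
  have hb := ascPhi_bounded hp0 hp1 hXY hX hY
  have hsp : ‖s * p‖ < 1 := by
    rw [norm_mul]; exact mul_lt_one_of_nonneg_of_lt_one_left (norm_nonneg _) hs1 hp1.le
  have h1 : genSeries p N X Y s 1 = genSeries p N X Y s 0 - genSeries p N X Y (s * p) 0 := by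
    simp only [genSeries]
    rw [← (summable_qWeight_mul hp1 hs1 N 0 hb).of_norm.tsum_sub
      (summable_qWeight_mul hp1 hsp N 0 hb).of_norm]
    refine tsum_congr fun j => ?_
    simp [qWeight, qFalling, mul_pow]
    ring
  have h := genSeries_recurrence hp0 hp1 hs hs1 hXY hX hY 0
  simp only [zero_add, h1, raiseCoeff, diagCoeff, lowerCoeff, pow_zero, sub_self, mul_zero,
    zero_mul, add_zero, mul_one, sub_zero, one_pow] at h
  have hi := inv_mul_cancel₀ hs
  linear_combination -s * h + s ^ 2 * genSeries p N X Y s 0 * hXY - (1 - s * p ^ (N + 1)) ^ 2 *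
    (genSeries p N X Y s 0 - genSeries p N X Y (s * p) 0) * hi

theorem genSeries_zero_iterate {p s : ℂ} (hp0 : p ≠ 0) (hp1 : ‖p‖ < 1) (hs : s ≠ 0)
    (hs1 : ‖s‖ < 1) {N : ℕ} {X Y : ℂ} (hXY : X * Y = p ^ (N + 1)) (hX : ‖X‖ < 1) (hY : ‖Y‖ < 1)
    (M : ℕ) :
    qPoch p (s * X) M * qPoch p (s * Y) M * genSeries p N X Y s 0 =
      qPoch p (s * p ^ (N + 1)) M ^ 2 * genSeries p N X Y (s * p ^ M) 0 := by
  induction M with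
  | zero => simp
  | succ M ih =>
    have hsM : ‖s * p ^ M‖ < 1 := by
      rw [norm_mul, norm_pow]
      exact mul_lt_one_of_nonneg_of_lt_one_left (norm_nonneg _) hs1
        (pow_le_one₀ (norm_nonneg _) hp1.le)
    have h := genSeries_zero_shift hp0 hp1 (mul_ne_zero hs (pow_ne_zero M hp0)) hsM hXY hX hY
    rw [qPoch_succ, qPoch_succ, qPoch_succ, show s * p ^ (M + 1) = s * p ^ M * p by ring]
    generalize genSeries p N X Y (s * p ^ M * p) 0 = Z at *
    linear_combination (1 - s * X * p ^ M) * (1 - s * Y * p ^ M) * ih +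
      qPoch p (s * p ^ (N + 1)) M ^ 2 * h

theorem tendsto_genSeries_zero {p s : ℂ} (hp0 : p ≠ 0) (hp1 : ‖p‖ < 1)
    (hs1 : ‖s‖ < 1) {N : ℕ} {X Y : ℂ} (hXY : X * Y = p ^ (N + 1)) (hX : ‖X‖ < 1) (hY : ‖Y‖ < 1) :
    Tendsto (fun M : ℕ => genSeries p N X Y (s * p ^ M) 0) atTop (𝓝 (qPoch p p N)) := by
  have hb := ascPhi_bounded hp0 hp1 hXY hX hY
  have hpt : Tendsto (fun M : ℕ => s * p ^ M) atTop (𝓝 0) := by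
    simpa using (tendsto_pow_atTop_nhds_zero_of_norm_lt_one hp1).const_mul s
  have hlim := tendsto_tsum_of_dominated_convergence (𝓕 := atTop)
    (f := fun (M : ℕ) j => qWeight p N (s * p ^ M) 0 j * ascPhi p N X Y j)
    (g := fun j => qWeight p N 0 0 j * ascPhi p N X Y j)
    (summable_qWeight_mul hp1 hs1 N 0 hb) (fun j => ?_) (Eventually.of_forall fun M j => ?_)
  · have h0 : ∑' j, qWeight p N 0 0 j * ascPhi p N X Y j = qPoch p p N := by
      rw [tsum_eq_single 0 fun j hj => by simp [qWeight, hj]]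
      simp [qWeight, qFalling, ascPhi]
    rw [h0] at hlim
    exact hlim
  · simp only [qWeight]
    exact (((hpt.pow j).mul_const _).mul_const _).mul_const _
  · simp only [qWeight, norm_mul, norm_pow]
    gcongr
    exact mul_le_of_le_one_right (norm_nonneg _) (pow_le_one₀ (norm_nonneg _) hp1.le)

/-- The infinite product `(a; p)_∞`. -/
noncomputable def qPochInf (p a : ℂ) : ℂ := ∏' i : ℕ, (1 - a * p ^ i)

theorem summable_norm_neg_mul_pow {p : ℂ} (hp1 : ‖p‖ < 1) (a : ℂ) :
    Summable fun i : ℕ => ‖-(a * p ^ i)‖ := by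
  simpa using (summable_geometric_of_lt_one (norm_nonneg p) hp1).mul_left ‖a‖

theorem tendsto_qPoch {p : ℂ} (hp1 : ‖p‖ < 1) (a : ℂ) :
    Tendsto (qPoch p a) atTop (𝓝 (qPochInf p a)) := by
  have := (multipliable_one_add_of_summable (summable_norm_neg_mul_pow hp1 a)).tendsto_prod_tprod_nat
  simp only [← sub_eq_add_neg] at this
  exact this

theorem qPochInf_ne_zero {p a : ℂ} (hp1 : ‖p‖ < 1) (ha : ‖a‖ < 1) : qPochInf p a ≠ 0 := by
  have := tprod_one_add_ne_zero_of_summable (f := fun i : ℕ => -(a * p ^ i)) (fun i h => ?_)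
    (summable_norm_neg_mul_pow hp1 a)
  · simp only [← sub_eq_add_neg] at this
    exact this
  · have h1 : ‖a * p ^ i‖ = 1 := by
      rw [← sub_eq_add_neg] at h
      rw [← sub_eq_zero.mp h, norm_one]
    rw [norm_mul, norm_pow] at h1
    exact absurd h1 (mul_lt_one_of_nonneg_of_lt_one_left (norm_nonneg _) ha
      (pow_le_one₀ (norm_nonneg _) hp1.le)).ne

theorem qPoch_add (p a : ℂ) (l m : ℕ) :
    qPoch p a (l + m) = qPoch p a l * qPoch p (a * p ^ l) m := by
  rw [qPoch, Finset.prod_range_add]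
  simp [qPoch, pow_add, mul_assoc]

theorem qPochInf_eq_mul {p : ℂ} (hp1 : ‖p‖ < 1) (a : ℂ) (l : ℕ) :
    qPochInf p a = qPoch p a l * qPochInf p (a * p ^ l) := by
  have h1 := (tendsto_qPoch hp1 (a * p ^ l)).const_mul (qPoch p a l)
  simp only [← qPoch_add] at h1
  have h2 := (tendsto_qPoch hp1 a).comp (tendsto_add_atTop_nat l)
  refine tendsto_nhds_unique h2 (h1.congr fun m => ?_)
  rw [Function.comp, add_comm]

theorem genSeries_zero_eq {p s : ℂ} (hp0 : p ≠ 0) (hp1 : ‖p‖ < 1) (hs : s ≠ 0)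
    (hs1 : ‖s‖ < 1) {N : ℕ} {X Y : ℂ} (hXY : X * Y = p ^ (N + 1)) (hX : ‖X‖ < 1) (hY : ‖Y‖ < 1) :
    qPoch p s (N + 1) * genSeries p N X Y s 0 = qPochInf p s * qPochInf p (s * p ^ (N + 1)) /
      (qPochInf p (s * X) * qPochInf p (s * Y)) * qPoch p p N := by
  have h1 := ((tendsto_qPoch hp1 (s * X)).mul (tendsto_qPoch hp1 (s * Y))).mul_const
    (genSeries p N X Y s 0)
  simp only [genSeries_zero_iterate hp0 hp1 hs hs1 hXY hX hY] at h1
  have h2 := tendsto_nhds_unique h1 (((tendsto_qPoch hp1 (s * p ^ (N + 1))).pow 2).mul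
    (tendsto_genSeries_zero hp0 hp1 hs1 hXY hX hY))
  have hne : ∀ Z : ℂ, ‖Z‖ < 1 → qPochInf p (s * Z) ≠ 0 := fun Z hZ =>
    qPochInf_ne_zero hp1 (by
      rw [norm_mul]; exact mul_lt_one_of_nonneg_of_lt_one_left (norm_nonneg _) hs1 hZ.le)
  have hXne := hne X hX
  have hYne := hne Y hY
  rw [qPochInf_eq_mul hp1 s (N + 1)]
  field_simp
  linear_combination qPoch p s (N + 1) * h2

/-- The spherical transform of the Berezin kernel. -/
theorem kerSum_genSeries {p s : ℂ} (hp0 : p ≠ 0) (hp1 : ‖p‖ < 1) (hs : s ≠ 0)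
    (hs1 : ‖s‖ < 1) {N : ℕ} {X Y : ℂ} (hXY : X * Y = p ^ (N + 1)) (hX : ‖X‖ < 1) (hY : ‖Y‖ < 1)
    (k : ℕ) :
    kerSum p N s (genSeries p N X Y s) k = qPochInf p s * qPochInf p (s * p ^ (N + 1)) /
      (qPochInf p (s * X) * qPochInf p (s * Y)) *
        (((p ^ (N + 1)) ^ k)⁻¹ * qPoch p (p ^ k * p) N * ascPhi p N X Y k) := by
  refine adjLap_eigen_unique hp0 hp1 N (g := fun k => qPochInf p s * qPochInf p (s * p ^ (N + 1)) /
      (qPochInf p (s * X) * qPochInf p (s * Y)) *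
        (((p ^ (N + 1)) ^ k)⁻¹ * qPoch p (p ^ k * p) N * ascPhi p N X Y k))
    (adjLap_kerSum hp0 hp1 hs N _ (X + Y)
      (genSeries_recurrence hp0 hp1 hs hs1 hXY hX hY)) (fun k => ?_) ?_ k
  · have h := adjLap_weighted_ascPhi hp0 hp1 hXY k
    rw [mul_left_comm, ← h]
    rcases k with _ | k <;> simp only [adjLap] <;> ring
  · have h := genSeries_zero_eq hp0 hp1 hs hs1 hXY hX hY
    have hq := qPoch_self_ne_zero hp1 N
    have hphi : ascPhi p N X Y 0 = 1 := by simp [ascPhi]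
    simp only [pow_zero, inv_one, one_mul, hphi, mul_one]
    rw [← h]
    simp [kerSum, kerCoeff, qWeight, qFalling, hq]

theorem qPoch_eq_qFalling {p : ℂ} (hp0 : p ≠ 0) {m j : ℕ} (h : m ≤ j) :
    qPoch p (p ^ (j - m + 1)) m = qFalling p m (p ^ j) := by
  rw [qPoch, qFalling, ← Finset.prod_range_reflect]
  refine Finset.prod_congr rfl fun i hi => ?_
  have hi' := Finset.mem_range.mp hi
  rw [← pow_add, show j - m + 1 + (m - 1 - i) = j - i by omega, pow_sub₀ _ hp0 (by omega),
    div_eq_mul_inv]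

theorem qpochC_eq_qPoch (q : ℝ) (a : ℂ) (m : ℕ) : qpochC q a m = qPoch ((q : ℂ) ^ 2) a m := by
  simp only [qpochC, qPoch, pow_mul]

theorem ofReal_qpochR (q a : ℝ) (m : ℕ) : (qpochR q a m : ℂ) = qPoch ((q : ℂ) ^ 2) a m := by
  simp [qpochR, qPoch, pow_mul]

theorem qpochCInf_eq_qPochInf (q : ℝ) (a : ℂ) : qpochCInf q a = qPochInf ((q : ℂ) ^ 2) a := by
  simp only [qpochCInf, qPochInf, pow_mul]

theorem sphPhi_eq_ascPhi (q : ℝ) (N : ℕ) (ρ : ℝ) (m : ℕ) :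
    sphPhi q (N + 1) ρ m = ascPhi ((q : ℂ) ^ 2) N (qcpow q (((N + 1 : ℕ) : ℂ) + ρ * Complex.I))
      (qcpow q (((N + 1 : ℕ) : ℂ) - ρ * Complex.I)) m := by
  simp only [sphPhi, ascPhi, qpochC_eq_qPoch, pow_mul]

theorem qcpow_add (q : ℝ) (z w : ℂ) : qcpow q (z + w) = qcpow q z * qcpow q w := by
  simp only [qcpow, add_mul, Complex.exp_add]

theorem qcpow_natCast {q : ℝ} (hq0 : 0 < q) (n : ℕ) : qcpow q n = (q : ℂ) ^ n := by
  rw [qcpow, Complex.exp_nat_mul, ← Complex.ofReal_exp, Real.exp_log hq0]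

theorem norm_qcpow {q : ℝ} (hq0 : 0 < q) (n : ℕ) (z : ℂ) (hz : z.re = n) :
    ‖qcpow q z‖ = q ^ n := by
  rw [qcpow, Complex.norm_exp, Complex.re_mul_ofReal, hz, mul_comm, Real.exp_mul,
    Real.exp_log hq0, Real.rpow_natCast]

/-- Expansion of the Berezin kernel into products of the weights `qWeight`. -/
theorem Brad_eq_sum {q : ℝ} (hq0 : 0 < q) (t : ℝ) (N k j : ℕ) :
    (Brad q t (N + 1) k j : ℂ) * ((q : ℂ) ^ (2 * (N + 1) * j))⁻¹ *
        qpochC q ((q : ℂ) ^ (2 * j + 2)) N =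
      ∑ m ∈ Finset.range (k + 1), kerCoeff ((q : ℂ) ^ 2) N (t * (q : ℂ) ^ 2) m *
        qWeight ((q : ℂ) ^ 2) N (t * (q : ℂ) ^ 2) m k *
        qWeight ((q : ℂ) ^ 2) N (t * (q : ℂ) ^ 2) m j := by
  have hq : (q : ℂ) ≠ 0 := by exact_mod_cast hq0.ne'
  have hp0 : (q : ℂ) ^ 2 ≠ 0 := pow_ne_zero 2 hq
  have hsub : Finset.range (min j k + 1) ⊆ Finset.range (k + 1) :=
    Finset.range_mono (by omega)
  rw [← Finset.sum_subset hsub fun m hm hm' => by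
    simp only [Finset.mem_range] at hm hm'
    rw [qWeight, qWeight, qFalling_pow_eq_zero hp0 (show j < m by omega)]
    simp]
  rw [Brad]
  push_cast
  rw [mul_assoc, mul_assoc, mul_left_comm, Finset.sum_mul]
  refine Finset.sum_congr rfl fun m hm => ?_
  have hm' := Finset.mem_range.mp hm
  have hj : m ≤ j := by omega
  have hk : m ≤ k := by omega
  simp only [ofReal_qpochR, qpochC_eq_qPoch]
  push_cast
  have hpw : ∀ i : ℕ, m ≤ i → (q : ℂ) ^ (2 * i - 2 * m + 2) = ((q : ℂ) ^ 2) ^ (i - m + 1) :=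
    fun i hi => by rw [← pow_mul]; congr 1; omega
  rw [hpw j hj, hpw k hk, qPoch_eq_qFalling hp0 hj, show N + 1 + m - 1 = m + N by omega,
    qPoch_add _ (((q : ℂ) ^ 2) ^ (k - m + 1)), qPoch_eq_qFalling hp0 hk, ← pow_add,
    show k - m + 1 + m = k + 1 by omega, show (q : ℂ) ^ (2 * j + 2) = ((q : ℂ) ^ 2) ^ (j + 1) by
      rw [← pow_mul]; ring, show (q : ℂ) ^ (2 * (N + 1) + 2) = q ^ 2 * ((q : ℂ) ^ 2) ^ (N + 1) by
      rw [← pow_mul]; ring, kerCoeff, qWeight, qWeight, ← pow_succ, ← pow_succ, add_comm m N,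
      mul_assoc (t : ℂ)]
  have e1 : (q : ℂ) ^ (2 * j * (N + 1 + 1)) * ((q : ℂ) ^ (2 * (N + 1) * j))⁻¹ =
      ((q : ℂ) ^ 2) ^ j := by
    rw [show 2 * j * (N + 1 + 1) = 2 * (N + 1) * j + 2 * j by ring, pow_add, pow_mul _ 2 j]
    field_simp
  have e2 : ((t : ℂ) ^ (2 * m))⁻¹ * ((q : ℂ) ^ (4 * m + 2 * m * (N + 1)))⁻¹ =
      ((t * (q : ℂ) ^ 2) ^ (2 * m) * (((q : ℂ) ^ 2) ^ (N + 1)) ^ m)⁻¹ := by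
    rw [← mul_inv]
    congr 1
    rw [mul_pow, ← pow_mul, ← pow_mul, ← pow_mul, mul_assoc ((t : ℂ) ^ (2 * m)), ← pow_add]
    ring_nf
  have e3 : (t : ℂ) ^ (k + j) * (q : ℂ) ^ (2 * k) * ((q : ℂ) ^ 2) ^ j =
      (t * (q : ℂ) ^ 2) ^ k * (t * (q : ℂ) ^ 2) ^ j := by
    rw [pow_mul]; ring
  simp only [div_eq_mul_inv, mul_inv] at e2 ⊢
  generalize qPoch ((q : ℂ) ^ 2) (((q : ℂ) ^ 2) ^ (j + 1)) N = Rj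
  generalize qPoch ((q : ℂ) ^ 2) (((q : ℂ) ^ 2) ^ (k + 1)) N = Rk
  generalize qFalling ((q : ℂ) ^ 2) m (((q : ℂ) ^ 2) ^ j) = Hj
  generalize qFalling ((q : ℂ) ^ 2) m (((q : ℂ) ^ 2) ^ k) = Hk
  generalize qPoch ((q : ℂ) ^ 2) (t * (q : ℂ) ^ 2) (N + 1 + m) = S
  generalize qPoch ((q : ℂ) ^ 2) (t * ((q : ℂ) ^ 2 * ((q : ℂ) ^ 2) ^ (N + 1))) m = Z
  generalize (qPoch ((q : ℂ) ^ 2) ((q : ℂ) ^ 2) (N + m))⁻¹ = a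
  generalize (qPoch ((q : ℂ) ^ 2) ((q : ℂ) ^ 2) m)⁻¹ = b
  generalize ((t : ℂ) ^ (2 * m))⁻¹ = T at e2 ⊢
  generalize ((q : ℂ) ^ (4 * m + 2 * m * (N + 1)))⁻¹ = Q at e2 ⊢
  generalize ((t * (q : ℂ) ^ 2) ^ (2 * m))⁻¹ = A at e2 ⊢
  generalize ((((q : ℂ) ^ 2) ^ (N + 1)) ^ m)⁻¹ = B at e2 ⊢
  generalize (t * (q : ℂ) ^ 2) ^ k = σk at e3 ⊢
  generalize (t * (q : ℂ) ^ 2) ^ j = σj at e3 ⊢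
  generalize (t : ℂ) ^ (k + j) * (q : ℂ) ^ (2 * k) = τ at e3 ⊢
  generalize (q : ℂ) ^ (2 * j * (N + 1 + 1)) = U at e1 ⊢
  generalize ((q : ℂ) ^ (2 * (N + 1) * j))⁻¹ = V at e1 ⊢
  generalize ((q : ℂ) ^ 2) ^ j = W at e1 e3
  linear_combination S * Z * a * b * Hk * Rk * Hj * Rj *
    (T * Q * τ * e1 + T * Q * e3 + σk * σj * e2)

/-- Proposition 5.1: under the q-spherical transform the radial q-Berezin transform becomes
multiplication by `b_{q,α}`: `𝓕(B_{q,α} f_k)(ρ) = b_{q,α}(ρ) 𝓕f_k(ρ)`, where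
`𝓕f_k(ρ) = (1 − q^{2n}) q^{−2nk} (q^{2k+2};q²)_{n−1} φ_ρ(q^{2k})`, the defining series
converging absolutely. -/
theorem statement12 (q : ℝ) (hq0 : 0 < q) (hq1 : q < 1) (n : ℕ) (hn : 1 ≤ n)
    (k : ℕ) (t : ℝ) (ht0 : 0 < t) (ht1 : t < 1) (ρ : ℝ) :
    Summable (fun j : ℕ => ‖(Brad q t n k j : ℂ) * sphPhi q n ρ j *
      ((q : ℂ) ^ (2 * n * j))⁻¹ * qpochC q ((q : ℂ) ^ (2 * j + 2)) (n - 1)‖) ∧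
    (1 - (q : ℂ) ^ (2 * n)) *
      ∑' j : ℕ, (Brad q t n k j : ℂ) * sphPhi q n ρ j * ((q : ℂ) ^ (2 * n * j))⁻¹ *
        qpochC q ((q : ℂ) ^ (2 * j + 2)) (n - 1) =
    bSym q t n ρ * ((1 - (q : ℂ) ^ (2 * n)) * ((q : ℂ) ^ (2 * n * k))⁻¹ *
      qpochC q ((q : ℂ) ^ (2 * k + 2)) (n - 1) * sphPhi q n ρ k) := by
  obtain ⟨N, rfl⟩ := Nat.exists_eq_add_of_le' hn
  rw [Nat.add_sub_cancel]
  have hq : (q : ℂ) ≠ 0 := by exact_mod_cast hq0.ne'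
  have ht : (t : ℂ) ≠ 0 := by exact_mod_cast ht0.ne'
  have hp0 : (q : ℂ) ^ 2 ≠ 0 := pow_ne_zero 2 hq
  have hp1 : ‖(q : ℂ) ^ 2‖ < 1 := by
    rw [norm_pow, Complex.norm_real, Real.norm_of_nonneg hq0.le]
    exact pow_lt_one₀ hq0.le hq1 two_ne_zero
  have hs : (t : ℂ) * (q : ℂ) ^ 2 ≠ 0 := mul_ne_zero ht hp0
  have hs1 : ‖(t : ℂ) * (q : ℂ) ^ 2‖ < 1 := by
    rw [norm_mul, Complex.norm_real, Real.norm_of_nonneg ht0.le]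
    exact mul_lt_one_of_nonneg_of_lt_one_left ht0.le ht1 hp1.le
  set X := qcpow q (((N + 1 : ℕ) : ℂ) + ρ * Complex.I) with hXdef
  set Y := qcpow q (((N + 1 : ℕ) : ℂ) - ρ * Complex.I) with hYdef
  have hXY : X * Y = ((q : ℂ) ^ 2) ^ (N + 1) := by
    rw [hXdef, hYdef, ← qcpow_add, ← pow_mul, ← qcpow_natCast hq0]
    congr 1
    push_cast
    ring
  have hX : ‖X‖ < 1 := by
    rw [hXdef, norm_qcpow hq0 (N + 1) _ (by simp)]
    exact pow_lt_one₀ hq0.le hq1 (by simp)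
  have hY : ‖Y‖ < 1 := by
    rw [hYdef, norm_qcpow hq0 (N + 1) _ (by simp)]
    exact pow_lt_one₀ hq0.le hq1 (by simp)
  have hb := ascPhi_bounded hp0 hp1 hXY hX hY
  have hterm : ∀ j, (Brad q t (N + 1) k j : ℂ) * sphPhi q (N + 1) ρ j *
      ((q : ℂ) ^ (2 * (N + 1) * j))⁻¹ * qpochC q ((q : ℂ) ^ (2 * j + 2)) N =
      ∑ m ∈ Finset.range (k + 1), kerCoeff ((q : ℂ) ^ 2) N (t * (q : ℂ) ^ 2) m *
        qWeight ((q : ℂ) ^ 2) N (t * (q : ℂ) ^ 2) m k *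
        (qWeight ((q : ℂ) ^ 2) N (t * (q : ℂ) ^ 2) m j * ascPhi ((q : ℂ) ^ 2) N X Y j) := by
    intro j
    simp only [← mul_assoc]
    rw [← Finset.sum_mul, ← Brad_eq_sum hq0 t, sphPhi_eq_ascPhi]
    ring
  have hsummable := fun m => summable_qWeight_mul hp1 hs1 N m hb
  simp only [hterm]
  refine ⟨(summable_sum fun m _ => (hsummable m).of_norm.mul_left _).norm, ?_⟩
  rw [Summable.tsum_finsetSum fun m _ => (hsummable m).of_norm.mul_left _]
  simp only [tsum_mul_left]
  have hmain := kerSum_genSeries hp0 hp1 hs hs1 hXY hX hY k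
  simp only [kerSum, genSeries] at hmain
  have hsh : ∀ z : ℂ, qcpow q (2 + z) = (q : ℂ) ^ 2 * qcpow q z := fun z => by
    rw [qcpow_add, ← qcpow_natCast hq0]; norm_num
  have hbs : bSym q t (N + 1) ρ = qPochInf ((q : ℂ) ^ 2) (t * (q : ℂ) ^ 2) *
      qPochInf ((q : ℂ) ^ 2) (t * (q : ℂ) ^ 2 * ((q : ℂ) ^ 2) ^ (N + 1)) /
      (qPochInf ((q : ℂ) ^ 2) (t * (q : ℂ) ^ 2 * X) *
        qPochInf ((q : ℂ) ^ 2) (t * (q : ℂ) ^ 2 * Y)) := by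
    simp only [bSym, qpochCInf_eq_qPochInf]
    rw [show ((N + 1 : ℕ) : ℂ) + 2 + ρ * Complex.I = 2 + (((N + 1 : ℕ) : ℂ) + ρ * Complex.I) by
      ring, show ((N + 1 : ℕ) : ℂ) + 2 - ρ * Complex.I =
        2 + (((N + 1 : ℕ) : ℂ) - ρ * Complex.I) by ring, hsh, hsh, ← hXdef, ← hYdef,
      show (q : ℂ) ^ (2 * (N + 1) + 2) = (q : ℂ) ^ 2 * ((q : ℂ) ^ 2) ^ (N + 1) by
        rw [← pow_mul]; ring]
    simp only [mul_assoc]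
  rw [hmain, hbs, sphPhi_eq_ascPhi, ← hXdef, ← hYdef, qpochC_eq_qPoch,
    show (q : ℂ) ^ (2 * k + 2) = ((q : ℂ) ^ 2) ^ k * (q : ℂ) ^ 2 by rw [← pow_mul]; ring,
    show (q : ℂ) ^ (2 * (N + 1) * k) = (((q : ℂ) ^ 2) ^ (N + 1)) ^ k by
      rw [← pow_mul, ← pow_mul, mul_assoc]]
  ring
end
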